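/- arXiv:1403.5664 — 2 statements merged into one kernel-verified Lean document; each statement's English description precedes it below -/
import Mathlib

section
/- The sum of the number of occurrences of the pattern 213 over all 123-avoiding permutations of {1,…,n} equals -(3/8)·4^n + (1/2)(n+2)(2n-1)·c_{n-1}, where c_m denotes the m-th Catalan number. -/
open Finset

/-- A permutation of `{1,…,n}` (modeled on `Fin n`) is 132-avoiding if there are
no indices `i < j < l` with `π i < π l < π j`. -/
def avoids132 {n : ℕ} (π : Equiv.Perm (Fin n)) : Prop :=
  ∀ i j l : Fin n, i < j → j < l → ¬(π i < π l ∧ π l < π j)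

instance avoids132.dec {n : ℕ} : DecidablePred (avoids132 (n := n)) := fun π => by
  unfold avoids132; infer_instance

/-- A permutation is 123-avoiding if there are no indices `i < j < l` with
`π i < π j < π l`. -/
def avoids123 {n : ℕ} (π : Equiv.Perm (Fin n)) : Prop :=
  ∀ i j l : Fin n, i < j → j < l → ¬(π i < π j ∧ π j < π l)

instance avoids123.dec {n : ℕ} : DecidablePred (avoids123 (n := n)) := fun π => by
  unfold avoids123; infer_instance

/-- The finite set of 132-avoiding permutations of `{1,…,n}`. -/
def AV132 (n : ℕ) : Finset (Equiv.Perm (Fin n)) := univ.filter avoids132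

/-- The finite set of 123-avoiding permutations of `{1,…,n}`. -/
def AV123 (n : ℕ) : Finset (Equiv.Perm (Fin n)) := univ.filter avoids123

/-- number of non-inversions: pairs `i < j` with `π i < π j` (pattern 12). -/
def a12 {n : ℕ} (π : Equiv.Perm (Fin n)) : ℕ :=
  (univ.filter (fun p : Fin n × Fin n => p.1 < p.2 ∧ π p.1 < π p.2)).card

/-- number of inversions: pairs `i < j` with `π j < π i` (pattern 21). -/
def a21 {n : ℕ} (π : Equiv.Perm (Fin n)) : ℕ :=
  (univ.filter (fun p : Fin n × Fin n => p.1 < p.2 ∧ π p.2 < π p.1)).card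

/-- occurrences of pattern 123: triples `i < j < l` with `π i < π j < π l`. -/
def a123 {n : ℕ} (π : Equiv.Perm (Fin n)) : ℕ :=
  (univ.filter (fun p : Fin n × Fin n × Fin n =>
    p.1 < p.2.1 ∧ p.2.1 < p.2.2 ∧ π p.1 < π p.2.1 ∧ π p.2.1 < π p.2.2)).card

/-- occurrences of pattern 321: triples `i < j < l` with `π l < π j < π i`. -/
def a321 {n : ℕ} (π : Equiv.Perm (Fin n)) : ℕ :=
  (univ.filter (fun p : Fin n × Fin n × Fin n =>
    p.1 < p.2.1 ∧ p.2.1 < p.2.2 ∧ π p.2.2 < π p.2.1 ∧ π p.2.1 < π p.1)).card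

/-- occurrences of pattern 231: triples `i < j < l` with `π l < π i < π j`. -/
def a231 {n : ℕ} (π : Equiv.Perm (Fin n)) : ℕ :=
  (univ.filter (fun p : Fin n × Fin n × Fin n =>
    p.1 < p.2.1 ∧ p.2.1 < p.2.2 ∧ π p.2.2 < π p.1 ∧ π p.1 < π p.2.1)).card

/-- occurrences of pattern 213: triples `i < j < l` with `π j < π i < π l`. -/
def a213 {n : ℕ} (π : Equiv.Perm (Fin n)) : ℕ :=
  (univ.filter (fun p : Fin n × Fin n × Fin n =>
    p.1 < p.2.1 ∧ p.2.1 < p.2.2 ∧ π p.2.1 < π p.1 ∧ π p.1 < π p.2.2)).card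

/-- occurrences of pattern 312: triples `i < j < l` with `π j < π l < π i`. -/
def a312 {n : ℕ} (π : Equiv.Perm (Fin n)) : ℕ :=
  (univ.filter (fun p : Fin n × Fin n × Fin n =>
    p.1 < p.2.1 ∧ p.2.1 < p.2.2 ∧ π p.2.1 < π p.2.2 ∧ π p.2.2 < π p.1)).card

/-- occurrences of pattern 4321: quadruples `i < j < l < m` with
`π m < π l < π j < π i`. -/
def a4321 {n : ℕ} (π : Equiv.Perm (Fin n)) : ℕ :=
  (univ.filter (fun p : Fin n × Fin n × Fin n × Fin n =>
    p.1 < p.2.1 ∧ p.2.1 < p.2.2.1 ∧ p.2.2.1 < p.2.2.2 ∧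
    π p.2.2.2 < π p.2.2.1 ∧ π p.2.2.1 < π p.2.1 ∧ π p.2.1 < π p.1)).card

namespace Equiv.Perm

/-- The permutation of `Fin (n + 1)` that starts with `v` and continues with a word
order-isomorphic to `σ`. -/
def prepend {n : ℕ} (v : Fin (n + 1)) (σ : Perm (Fin n)) : Perm (Fin (n + 1)) :=
  (finSuccEquiv n).trans ((optionCongr σ).trans (finSuccEquiv' v).symm)

@[simp]
theorem prepend_zero {n : ℕ} (v : Fin (n + 1)) (σ : Perm (Fin n)) : prepend v σ 0 = v := by
  simp [prepend]

@[simp]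
theorem prepend_succ {n : ℕ} (v : Fin (n + 1)) (σ : Perm (Fin n)) (i : Fin n) :
    prepend v σ i.succ = v.succAbove (σ i) := by
  simp [prepend]

theorem prepend_bijective (n : ℕ) :
    Function.Bijective (fun p : Fin (n + 1) × Perm (Fin n) => prepend p.1 p.2) := by
  rw [Fintype.bijective_iff_injective_and_card]
  constructor
  · rintro ⟨v, σ⟩ ⟨w, τ⟩ h
    have key (i : Fin (n + 1)) : prepend v σ i = prepend w τ i := congrArg (· i) h
    obtain rfl : v = w := by simpa using key 0
    have : σ = τ := Equiv.ext fun i => by simpa using key i.succ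
    rw [this]
  · simp [Fintype.card_perm, Nat.factorial_succ]

/-- `σ` lists its `k` largest values in decreasing order, and there are `k` of them. -/
def TopDecreasing {n : ℕ} (k : ℕ) (σ : Perm (Fin n)) : Prop :=
  k ≤ n ∧ ∀ i j : Fin n, i < j → σ i < σ j → (σ i : ℕ) + k < n

instance {n : ℕ} (k : ℕ) : DecidablePred (TopDecreasing (n := n) k) := fun σ => by
  unfold TopDecreasing; infer_instance

theorem topDecreasing_zero {n : ℕ} (σ : Perm (Fin n)) : TopDecreasing 0 σ :=
  ⟨Nat.zero_le n, fun i _ _ _ => (σ i).isLt⟩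

theorem topDecreasing_one {n : ℕ} (σ : Perm (Fin (n + 1))) : TopDecreasing 1 σ :=
  ⟨by omega, fun i j _ h => by have := (σ j).isLt; rw [Fin.lt_def] at h; omega⟩

theorem succAbove_val {n : ℕ} (v : Fin (n + 1)) (x : Fin n) :
    (v.succAbove x : ℕ) = if (x : ℕ) < v then (x : ℕ) else x + 1 := by
  simp only [Fin.succAbove, Fin.lt_def, Fin.val_castSucc]
  split_ifs <;> simp

theorem avoids123_prepend {n : ℕ} (v : Fin (n + 1)) (σ : Perm (Fin n)) :
    avoids123 (prepend v σ) ↔ avoids123 σ ∧ TopDecreasing (n - v) σ := by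
  have hv := v.isLt
  unfold avoids123 TopDecreasing
  simp only [Fin.forall_fin_succ, prepend_zero, prepend_succ, Fin.lt_def, succAbove_val,
    Fin.val_succ, Fin.val_zero]
  constructor
  · rintro ⟨⟨-, h⟩, h'⟩
    refine ⟨fun i j l hij hjl hh => ?_, by omega, fun i j hij hh => ?_⟩
    · refine (h' i).2 j |>.2 l (by omega) (by omega) ?_
      grind
    · have := (h i).2 j (by omega) (by omega)
      grind
  · rintro ⟨h, -, h'⟩
    refine ⟨⟨by grind, fun j => ⟨by grind, fun l => ?_⟩⟩,
      fun i => ⟨by grind, fun j => ⟨by grind, fun l => ?_⟩⟩⟩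
    · have := h' j l
      grind
    · have := h i j l
      grind

theorem topDecreasing_prepend_last {n : ℕ} (k : ℕ) (σ : Perm (Fin n)) :
    TopDecreasing (k + 1) (prepend (Fin.last n) σ) ↔ TopDecreasing k σ := by
  unfold TopDecreasing
  simp only [Fin.forall_fin_succ, prepend_zero, prepend_succ, Fin.lt_def, succAbove_val,
    Fin.val_succ, Fin.val_zero, Fin.val_last, Fin.is_lt, if_true]
  constructor
  · rintro ⟨hk, h, h'⟩
    exact ⟨by omega, fun i j hij hh => by have := (h' i).2 j (by omega) hh; omega⟩
  · rintro ⟨hk, h⟩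
    refine ⟨by omega, ⟨by omega, fun j => by omega⟩, fun i => ⟨by omega, fun j hij hh => ?_⟩⟩
    have := h i j (by omega) hh
    omega

theorem topDecreasing_prepend_castSucc {n : ℕ} (k : ℕ) (x : Fin n) (σ : Perm (Fin n))
    (hσ : TopDecreasing (n - x) σ) :
    TopDecreasing k (prepend x.castSucc σ) ↔ k ≤ n - x := by
  have hx := x.isLt
  constructor
  · rintro ⟨-, h⟩
    have := h 0 (σ.symm x).succ (Fin.succ_pos _) (by simp [Fin.lt_def])
    simp at this
    omega
  · intro hk
    refine ⟨by omega, ?_⟩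
    simp only [Fin.forall_fin_succ, prepend_zero, prepend_succ, Fin.lt_def, succAbove_val,
      Fin.val_succ, Fin.val_zero, Fin.val_castSucc]
    refine ⟨⟨by omega, fun j => by omega⟩, fun i => ⟨by omega, fun j hij hh => ?_⟩⟩
    have := hσ.2 i j
    grind

/-- The sum of `f` over the `123`-avoiding permutations whose `k` largest values appear in
decreasing order. -/
def levelSum (n k : ℕ) (f : Perm (Fin n) → ℚ) : ℚ :=
  ∑ σ, if avoids123 σ ∧ TopDecreasing k σ then f σ else 0

theorem levelSum_zero (n : ℕ) (f : Perm (Fin n) → ℚ) : levelSum n 0 f = ∑ σ ∈ AV123 n, f σ := by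
  simp [levelSum, AV123, sum_filter, topDecreasing_zero]

theorem levelSum_succ_zero (n : ℕ) (f : Perm (Fin (n + 1)) → ℚ) :
    levelSum (n + 1) 0 f = levelSum (n + 1) 1 f := by
  simp [levelSum, topDecreasing_zero, topDecreasing_one]

theorem levelSum_eq_zero {n k : ℕ} (h : n < k) (f : Perm (Fin n) → ℚ) : levelSum n k f = 0 :=
  sum_eq_zero fun _ _ => if_neg fun hσ => absurd hσ.2.1 (by omega)

theorem levelSum_succ_succ (n k : ℕ) (f : Perm (Fin (n + 1)) → ℚ) :
    levelSum (n + 1) (k + 1) f = levelSum n k (fun σ => f (prepend (Fin.last n) σ)) +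
      ∑ x : Fin n, if k + 1 ≤ n - x then
        levelSum n (n - x) (fun σ => f (prepend x.castSucc σ)) else 0 := by
  rw [levelSum, ← (prepend_bijective n).sum_comp, Fintype.sum_prod_type, Fin.sum_univ_castSucc,
    add_comm]
  congr 1
  · refine sum_congr rfl fun σ _ => ?_
    simp [avoids123_prepend, topDecreasing_prepend_last, topDecreasing_zero]
  · refine sum_congr rfl fun x _ => ?_
    have hx (σ : Perm (Fin n)) : avoids123 (prepend x.castSucc σ) ∧
        TopDecreasing (k + 1) (prepend x.castSucc σ) ↔
        k + 1 ≤ n - x ∧ avoids123 σ ∧ TopDecreasing (n - x) σ := by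
      rw [avoids123_prepend, Fin.val_castSucc]
      constructor
      · rintro ⟨⟨h, h'⟩, h''⟩
        exact ⟨(topDecreasing_prepend_castSucc _ x σ h').1 h'', h, h'⟩
      · rintro ⟨hk, h, h'⟩
        exact ⟨⟨h, h'⟩, (topDecreasing_prepend_castSucc _ x σ h').2 hk⟩
    simp only [hx]
    split_ifs with hk <;> simp [levelSum, hk]

/-- Occurrences of the pattern 132: triples `i < j < l` with `π i < π l < π j`. -/
def count132 {n : ℕ} (π : Perm (Fin n)) : ℕ :=
  (univ.filter (fun p : Fin n × Fin n × Fin n =>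
    p.1 < p.2.1 ∧ p.2.1 < p.2.2 ∧ π p.1 < π p.2.2 ∧ π p.2.2 < π p.2.1)).card

theorem sum_range_tsub (v n : ℕ) : ∑ b ∈ range n, (b - v) = (n - v).choose 2 := by
  induction n with
  | zero => simp
  | succ n ih =>
    rw [sum_range_succ, ih]
    rcases le_or_gt v n with h | h
    · rw [Nat.succ_sub h, Nat.choose_succ_succ' _ 1, Nat.choose_one_right, add_comm]
    · simp [Nat.sub_eq_zero_of_le h.le, Nat.sub_eq_zero_of_le (Nat.succ_le_of_lt h)]

theorem card_pairs_above (n v : ℕ) :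
    (univ.filter fun p : Fin n × Fin n => v ≤ p.1 ∧ p.1 < p.2).card = (n - v).choose 2 := by
  rw [← sum_range_tsub, card_filter, Fintype.sum_prod_type_right, sum_range]
  refine sum_congr rfl fun b _ => ?_
  rw [← card_filter, ← Nat.card_Ico, ← card_map Fin.valEmbedding]
  congr 1
  ext a
  simp only [mem_map, mem_filter, mem_univ, true_and, Fin.valEmbedding_apply, mem_Ico]
  constructor
  · rintro ⟨a, h, rfl⟩
    exact h
  · intro h
    exact ⟨⟨a, by omega⟩, h, rfl⟩

theorem count132_prepend {n : ℕ} (v : Fin (n + 1)) (σ : Perm (Fin n))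
    (hσ : TopDecreasing (n - v) σ) :
    count132 (prepend v σ) = count132 σ + (n - v).choose 2 := by
  have hpairs : (univ.filter fun p : Fin n × Fin n =>
      p.1 < p.2 ∧ v < v.succAbove (σ p.2) ∧ σ p.2 < σ p.1).card = (n - v).choose 2 := by
    rw [← card_pairs_above]
    refine card_bij (fun p _ => (σ p.2, σ p.1)) ?_ ?_ ?_
    · simp only [mem_filter, mem_univ, true_and, Fin.lt_def, succAbove_val]
      grind
    · rintro ⟨a, b⟩ - ⟨c, d⟩ - h
      simpa [and_comm] using h
    · rintro ⟨a, b⟩ h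
      refine ⟨(σ.symm b, σ.symm a), ?_, by simp⟩
      simp only [mem_filter, mem_univ, true_and, apply_symm_apply] at h ⊢
      refine ⟨?_, ?_, h.2⟩
      · by_contra hle
        have hne : σ.symm a ≠ σ.symm b := fun he => h.2.ne (σ.symm.injective he)
        have := hσ.2 (σ.symm a) (σ.symm b) (by grind) (by simpa using h.2)
        simp only [apply_symm_apply] at this
        omega
      · rw [Fin.lt_def, succAbove_val]
        grind
  rw [← hpairs]
  simp only [count132, card_filter, Fintype.sum_prod_type, Fin.sum_univ_succ]
  have hsucc (i j : Fin n) : v.succAbove i < v.succAbove j ↔ i < j :=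
    Fin.succAbove_lt_succAbove_iff
  simp only [prepend_zero, prepend_succ, lt_irrefl, Fin.succ_pos, Fin.not_lt_zero, hsucc,
    Fin.succ_lt_succ_iff, false_and, and_false, true_and, if_false, sum_const_zero, zero_add]
  exact add_comm _ _

/-- The number of `123`-avoiding permutations whose `k` largest values decrease. -/
def levelCount (n k : ℕ) : ℚ := levelSum n k fun _ => 1

/-- The total number of occurrences of 132 in the `123`-avoiding permutations whose `k` largest
values decrease. -/
def level132 (n k : ℕ) : ℚ := levelSum n k fun σ => count132 σ

theorem levelSum_count132_prepend {n k : ℕ} (v : Fin (n + 1)) (hk : n - v ≤ k) :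
    levelSum n k (fun σ => count132 (prepend v σ)) =
      level132 n k + (n - v).choose 2 * levelCount n k := by
  simp only [level132, levelCount, levelSum, mul_sum, ← sum_add_distrib]
  refine sum_congr rfl fun σ _ => ?_
  split_ifs with h
  · have hσ : TopDecreasing (n - v) σ :=
      ⟨by omega, fun i j hij hh => by have := h.2.2 i j hij hh; omega⟩
    simp [count132_prepend v σ hσ]
  · simp

theorem sum_ite_succ_le_sub {n k : ℕ} (f : ℕ → ℚ) (hf : n < k + 1 → f (k + 1) = 0) :
    (∑ x : Fin n, if k + 1 ≤ n - x then f (n - x) else 0) =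
      (∑ x : Fin n, if k + 2 ≤ n - x then f (n - x) else 0) + f (k + 1) := by
  have hsplit (x : Fin n) : (if k + 1 ≤ n - x then f (n - x) else 0) =
      (if k + 2 ≤ n - x then f (n - x) else 0) + if n - x = k + 1 then f (k + 1) else 0 := by
    grind
  simp only [hsplit, sum_add_distrib]
  congr 1
  rcases lt_or_ge n (k + 1) with h | h
  · simp [hf h]
  · rw [sum_eq_single ⟨n - (k + 1), by omega⟩]
    · rw [if_pos (by simp only; omega)]
    · intro x _ hx
      have := x.isLt
      exact if_neg fun he => hx (Fin.ext (by simp only; omega))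
    · simp

theorem levelCount_succ_succ (n k : ℕ) :
    levelCount (n + 1) (k + 1) = levelCount (n + 1) (k + 2) + levelCount n k := by
  have h1 := levelSum_succ_succ n k fun _ => 1
  have h2 := levelSum_succ_succ n (k + 1) fun _ => 1
  have h3 := sum_ite_succ_le_sub (n := n) (k := k) (levelCount n) fun h => levelSum_eq_zero h _
  simp only [levelCount] at *
  linarith

theorem level132_succ_succ (n k : ℕ) :
    level132 (n + 1) (k + 1) = level132 (n + 1) (k + 2) + level132 n k +
      (k + 1).choose 2 * levelCount n (k + 1) := by
  have hrec (k : ℕ) : level132 (n + 1) (k + 1) = level132 n k + ∑ x : Fin n,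
      if k + 1 ≤ n - x then level132 n (n - x) + (n - x : ℕ).choose 2 * levelCount n (n - x)
        else 0 := by
    rw [level132, levelSum_succ_succ, levelSum_count132_prepend _ (by simp)]
    simp [levelSum_count132_prepend]
  have h1 := hrec k
  have h2 := hrec (k + 1)
  have h3 := sum_ite_succ_le_sub (n := n) (k := k)
    (fun j => level132 n j + j.choose 2 * levelCount n j)
    fun h => by simp [level132, levelCount, levelSum_eq_zero h]
  linarith

theorem cast_choose_succ (m k : ℕ) :
    ((2 * m + k + 1).choose (m + 1) : ℚ) =
      (2 * m + k + 1).choose m * (m + k + 1) / (m + 1) := by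
  rw [eq_div_iff (by positivity)]
  have h := Nat.choose_succ_right_eq (2 * m + k + 1) m
  rw [show 2 * m + k + 1 - m = m + k + 1 by omega] at h
  exact_mod_cast h

theorem cast_choose_succ_succ (m k : ℕ) :
    ((2 * (m + 1) + k).choose (m + 1) : ℚ) =
      (2 * m + k + 1).choose m * (2 * m + k + 2) / (m + 1) := by
  rw [show 2 * (m + 1) + k = 2 * m + k + 1 + 1 by ring, Nat.choose_succ_succ', Nat.cast_add,
    cast_choose_succ]
  field_simp
  ring

theorem levelCount_eq (m k : ℕ) :
    levelCount (m + k) k = (2 * m + k).choose m * (k + 1) / (m + k + 1) := by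
  induction m generalizing k with
  | zero =>
    have hdiag : levelCount k k = 1 := by
      induction k with
      | zero => simp [levelCount, levelSum, avoids123, topDecreasing_zero]
      | succ k ih =>
        rw [levelCount_succ_succ, ih, levelCount, levelSum_eq_zero (by omega), zero_add]
    have : (k : ℚ) + 1 ≠ 0 := by positivity
    simp [hdiag, this]
  | succ m ihm =>
    induction k with
    | zero =>
      rw [levelCount, add_zero, levelSum_succ_zero, ← levelCount, ihm, cast_choose_succ_succ]
      push_cast
      field_simp
      ring
    | succ k ihk =>
      have h := levelCount_succ_succ (m + 1 + k) k
      rw [ihk, show m + 1 + k + 1 = m + (k + 2) by omega, ihm] at h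
      have hY := cast_choose_succ m (k + 1)
      have hZ := cast_choose_succ_succ m (k + 1)
      simp only [show 2 * m + (k + 1) + 1 = 2 * m + (k + 2) by ring] at hY hZ
      rw [show m + 1 + (k + 1) = m + (k + 2) by omega, h, hZ,
        show 2 * (m + 1) + k = 2 * m + (k + 2) by ring, hY]
      push_cast
      field_simp
      ring

theorem sum_choose_succ (t m : ℕ) :
    ∑ i ∈ range (m + 2), ((t + 1).choose i : ℚ) =
      2 * ∑ i ∈ range (m + 1), (t.choose i : ℚ) + t.choose (m + 1) := by
  rw [sum_range_succ', sum_congr rfl fun i _ => by rw [Nat.choose_succ_succ', Nat.cast_add],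
    sum_add_distrib]
  have h := sum_range_succ' (fun i => (t.choose i : ℚ)) (m + 1)
  rw [sum_range_succ] at h
  simp only [Nat.choose_zero_right] at h ⊢
  linarith

theorem level132_diag (k : ℕ) : level132 k k = 0 := by
  induction k with
  | zero => simp [level132, levelSum, count132]
  | succ k ih =>
    rw [level132_succ_succ, ih, level132, levelCount, levelSum_eq_zero (by omega),
      levelSum_eq_zero (by omega)]
    simp

theorem level132_eq (m k : ℕ) :
    level132 (m + 1 + k) k = (k + 1) * (-3 * ∑ i ∈ range (m + 1), ((2 * m + k).choose i : ℚ) +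
      (2 * m + k).choose m * (m ^ 2 + m * (5 + k / 6 + k ^ 2 / 3) + 3 + 17 * k / 6 + k ^ 3 / 6) /
        (m + k + 1)) := by
  induction m generalizing k with
  | zero =>
    induction k with
    | zero =>
      rw [level132, zero_add, levelSum_succ_zero, ← level132, level132_diag]
      simp
    | succ k ih =>
      rw [← add_assoc, level132_succ_succ, ih, show 0 + 1 + k + 1 = k + 2 by ring, level132_diag,
        show 0 + 1 + k = 0 + (k + 1) by ring, levelCount_eq, Nat.cast_choose_two]
      simp
      field_simp
      ring
  | succ m ihm =>
    induction k with
    | zero =>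
      rw [level132, levelSum_succ_zero, ← level132, ihm,
        show 2 * (m + 1) + 0 = 2 * m + 1 + 1 by ring, sum_choose_succ]
      have h := cast_choose_succ m 0
      have h' := cast_choose_succ_succ m 0
      simp only [add_zero, show 2 * (m + 1) = 2 * m + 1 + 1 by ring] at h h'
      rw [h, h']
      push_cast
      field_simp
      ring
    | succ k ih =>
      have hY := cast_choose_succ m (k + 1)
      have hZ := cast_choose_succ_succ m (k + 1)
      have hS := sum_choose_succ (2 * m + k + 2) m
      rw [← add_assoc, level132_succ_succ, ih, show m + 1 + 1 + k + 1 = m + 1 + (k + 2) by ring,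
        ihm, show m + 1 + 1 + k = m + 1 + (k + 1) by ring, levelCount_eq, Nat.cast_choose_two, hZ,
        show 2 * (m + 1) + (k + 1) = 2 * m + k + 2 + 1 by ring, hS,
        show 2 * (m + 1) + k = 2 * m + k + 2 by ring, sum_range_succ _ (m + 1)]
      simp only [show 2 * m + (k + 1) + 1 = 2 * m + k + 2 by ring,
        show 2 * m + (k + 2) = 2 * m + k + 2 by ring] at hY ⊢
      rw [hY]
      push_cast
      field_simp
      ring

/-- Conjugation by the reversal, i.e. the reverse-complement of a permutation. -/
def reverseComplement (n : ℕ) : Perm (Fin n) ≃ Perm (Fin n) := Fin.revPerm.permCongr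

theorem reverseComplement_apply {n : ℕ} (π : Perm (Fin n)) (i : Fin n) :
    reverseComplement n π i = (π i.rev).rev := rfl

theorem avoids123_reverseComplement {n : ℕ} (π : Perm (Fin n)) :
    avoids123 (reverseComplement n π) ↔ avoids123 π := by
  simp only [avoids123, reverseComplement_apply, Fin.rev_lt_rev]
  constructor
  · intro h i j l hij hjl hh
    exact h l.rev j.rev i.rev (by simpa) (by simpa) (by simpa using hh.symm)
  · intro h i j l hij hjl hh
    exact h l.rev j.rev i.rev (by simpa) (by simpa) hh.symm

theorem count132_reverseComplement {n : ℕ} (π : Perm (Fin n)) :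
    count132 (reverseComplement n π) = a213 π := by
  let e : Fin n × Fin n × Fin n ≃ Fin n × Fin n × Fin n :=
    { toFun := fun p => (p.2.2.rev, p.2.1.rev, p.1.rev)
      invFun := fun p => (p.2.2.rev, p.2.1.rev, p.1.rev)
      left_inv := fun p => by simp
      right_inv := fun p => by simp }
  refine card_equiv e fun p => ?_
  simp only [e, coe_fn_mk, mem_filter, mem_univ, true_and, reverseComplement_apply,
    Fin.rev_lt_rev]
  tauto

theorem sum_a213_eq_level132 (n : ℕ) : ∑ π ∈ AV123 n, (a213 π : ℚ) = level132 n 0 := by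
  rw [level132, levelSum_zero]
  refine sum_equiv (reverseComplement n) (fun π => ?_) fun π _ => ?_
  · simp [AV123, avoids123_reverseComplement]
  · rw [count132_reverseComplement]

theorem two_mul_sum_choose_halfway (m : ℕ) :
    2 * ∑ i ∈ range (m + 1), ((2 * m).choose i : ℚ) = 4 ^ m + (2 * m).choose m := by
  have h : ∑ i ∈ range (m + 1), ((2 * m + 1).choose i : ℚ) = 4 ^ m := by
    exact_mod_cast Nat.sum_range_choose_halfway m
  cases m with
  | zero => norm_num
  | succ m =>
    rw [sum_choose_succ] at h
    rw [sum_range_succ]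
    linarith

end Equiv.Perm

open Equiv.Perm in
/-- For `n ≥ 1`,
`∑_{π ∈ AV₁₂₃(n)} a₂₁₃(π) = -(3/8)·4^n + (1/2)(n+2)(2n-1)·c_{n-1}`. -/
theorem sum_a213_over_AV123 (n : ℕ) (hn : 1 ≤ n) :
    (∑ π ∈ AV123 n, (a213 π : ℚ)) =
      -(3 / 8) * 4 ^ n
        + (1 / 2) * ((n : ℚ) + 2) * (2 * (n : ℚ) - 1) * (catalan (n - 1) : ℚ) := by
  obtain ⟨m, rfl⟩ := Nat.exists_eq_add_of_le' hn
  have hcat : ((2 * m).choose m : ℚ) = (m + 1) * catalan m := by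
    exact_mod_cast (succ_mul_catalan_eq_centralBinom m).symm
  have hhalf := two_mul_sum_choose_halfway m
  have h := level132_eq m 0
  rw [add_zero, add_zero] at h
  rw [sum_a213_eq_level132, h, eq_div_of_mul_eq two_ne_zero ((mul_comm _ _).trans hhalf), hcat,
    Nat.add_sub_cancel]
  push_cast
  field_simp
  ring
end

section
/- The sum of the squares of the number of occurrences of the pattern 213 over all 123-avoiding permutations of {1,…,n} equals -(9/128)(3n²+7n+6)·4^n + ((19/60)n⁴ + (57/20)n³ + (67/30)n² + (1/10)n - 1)·c_{n-1}. -/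
open Finset

open Nat in
/-- The ballot-type number `(2m+g)! / (m! (m+g+2)!)`. -/
def ballot (m g : ℕ) : ℚ := (2 * m + g)! / (m ! * (m + g + 2)!)

/-- The partial binomial sum `∑_{j ≤ m} binom(N, j)`. -/
def partialSum (N m : ℕ) : ℚ := ∑ j ∈ range (m + 1), (N.choose j : ℚ)

lemma partialSum_succ_right (N m : ℕ) :
    partialSum N (m + 1) = partialSum N m + N.choose (m + 1) := by
  simp [partialSum, sum_range_succ _ (m + 1)]

lemma partialSum_succ_left (N m : ℕ) :
    partialSum (N + 1) m = 2 * partialSum N m - N.choose m := by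
  induction m with
  | zero => simp [partialSum]; norm_num
  | succ m ih =>
    rw [partialSum_succ_right, partialSum_succ_right, ih, Nat.choose_succ_succ]
    push_cast
    ring

lemma partialSum_two_mul_add_two (m : ℕ) :
    partialSum (2 * m + 2) m = 2 * 4 ^ m - (2 * m + 2).choose (m + 1) / 2 := by
  have halfway : partialSum (2 * m + 1) m = 4 ^ m := by
    have := Nat.sum_range_choose_halfway m
    unfold partialSum
    exact_mod_cast this
  have hsymm : (2 * m + 1).choose (m + 1) = (2 * m + 1).choose m :=
    Nat.choose_symm_half m
  rw [partialSum_succ_left, halfway, Nat.choose_succ_succ (2 * m + 1) m, hsymm]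
  push_cast
  ring

/-- The number of ways to continue for `m` steps from label `g + 1` in the generating tree of
123-avoiding permutations. -/
def count0 (m g : ℕ) : ℚ := (g + 2) * (2 * m + g + 1) * ballot m g

/-- The total increase of the number of 213-patterns over all continuations counted by
`count0 m g`. -/
def count1 (m g : ℕ) : ℚ :=
  let x : ℚ := m
  let y : ℚ := g
  (y + 2) * ((18 + 27 * y + 9 * y ^ 2
    + (57 + 41 * y + 12 * y ^ 2 + 4 * y ^ 3) * x
    + (48 + 16 * y + 4 * y ^ 2) * x ^ 2
    + 12 * x ^ 3) / 24 * ballot m g - 3 / 8 * partialSum (2 * m + g + 2) m)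

/-- The sum of the squared increases of the number of 213-patterns over all continuations
counted by `count0 m g`. At `m = g = 0` the quotient by `2 * m + g` is zero, as required. -/
def count2 (m g : ℕ) : ℚ :=
  let x : ℚ := m
  let y : ℚ := g
  (y + 2) * ((9 / 4 +
    (126900 * y ^ 2 + 118260 * y ^ 3 + 54135 * y ^ 4 + 11475 * y ^ 5 + 405 * y ^ 6 - 135 * y ^ 7
    + (462432 * y + 598902 * y ^ 2 + 349231 * y ^ 3 + 94327 * y ^ 4 + 7853 * y ^ 5
      - 433 * y ^ 6) * x
    + (423024 + 1020784 * y + 816154 * y ^ 2 + 271078 * y ^ 3 + 34766 * y ^ 4 + 3458 * y ^ 5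
      + 640 * y ^ 6) * x ^ 2
    + (582120 + 856604 * y + 379968 * y ^ 2 + 59776 * y ^ 3 + 9332 * y ^ 4 + 1280 * y ^ 5) * x ^ 3
    + (349080 + 273080 * y + 50920 * y ^ 2 + 10440 * y ^ 3 + 640 * y ^ 4) * x ^ 4
    + (90000 + 21904 * y + 4864 * y ^ 2) * x ^ 5
    + 7296 * x ^ 6) / 23040 / (2 * x + y)) * ballot m g
    + (-576 - 546 * y - 207 * y ^ 2 - 18 * y ^ 3 + 3 * y ^ 4
    + (-468 - 252 * y - 36 * y ^ 2) * x - 108 * x ^ 2) / 512 * partialSum (2 * m + g + 2) m)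

lemma partialSum_zero_right (N : ℕ) : partialSum N 0 = 1 := by simp [partialSum]

lemma ballot_zero_left (g : ℕ) : ballot 0 g = 1 / ((g + 1) * (g + 2)) := by
  simp only [ballot, mul_zero, zero_add, Nat.factorial_succ, Nat.factorial_zero]
  have := Nat.cast_ne_zero (R := ℚ).2 (Nat.factorial_ne_zero g)
  push_cast
  field_simp
  ring

lemma count0_zero_left (g : ℕ) : count0 0 g = 1 := by
  rw [count0, ballot_zero_left]
  push_cast
  field_simp
  ring

lemma count1_zero_left (g : ℕ) : count1 0 g = 0 := by
  simp only [count1, ballot_zero_left, partialSum_zero_right]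
  push_cast
  field_simp
  ring

lemma count2_zero_left (g : ℕ) : count2 0 g = 0 := by
  simp only [count2, ballot_zero_left, partialSum_zero_right]
  rcases Nat.eq_zero_or_pos g with rfl | hg
  · norm_num
  have : (g : ℚ) ≠ 0 := by positivity
  push_cast
  field_simp
  ring

lemma ballot_succ_right (m g : ℕ) :
    ballot m (g + 1) = (2 * m + g + 1) / (m + g + 3) * ballot m g := by
  have h₁ := Nat.cast_ne_zero (R := ℚ).2 (Nat.factorial_ne_zero m)
  have h₂ := Nat.cast_ne_zero (R := ℚ).2 (Nat.factorial_ne_zero (m + g + 2))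
  simp only [ballot, show 2 * m + (g + 1) = 2 * m + g + 1 by ring,
    show m + (g + 1) + 2 = m + g + 2 + 1 by ring, Nat.factorial_succ (2 * m + g),
    Nat.factorial_succ (m + g + 2)]
  push_cast
  field_simp
  ring

lemma ballot_succ_left (m g : ℕ) :
    ballot (m + 1) g = (2 * m + g + 2) / (m + 1) * ballot m (g + 1) := by
  have h₁ := Nat.cast_ne_zero (R := ℚ).2 (Nat.factorial_ne_zero m)
  have h₂ := Nat.cast_ne_zero (R := ℚ).2 (Nat.factorial_ne_zero (m + g + 3))
  simp only [ballot, show 2 * (m + 1) + g = 2 * m + g + 1 + 1 by ring,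
    show 2 * m + (g + 1) = 2 * m + g + 1 by ring,
    show m + 1 + g + 2 = m + g + 3 by ring, show m + (g + 1) + 2 = m + g + 3 by ring,
    Nat.factorial_succ (2 * m + g + 1), Nat.factorial_succ m]
  push_cast
  field_simp
  ring

lemma choose_eq_ballot (m g : ℕ) :
    ((2 * m + g + 2).choose m : ℚ) = (2 * m + g + 2) * (2 * m + g + 1) * ballot m g := by
  rw [show 2 * m + g + 2 = m + (m + g + 2) by ring, Nat.cast_add_choose, ballot,
    show m + (m + g + 2) = 2 * m + g + 1 + 1 by ring, Nat.factorial_succ, Nat.factorial_succ]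
  push_cast
  ring

lemma choose_succ_eq_ballot (m g : ℕ) :
    ((2 * m + g + 2).choose (m + 1) : ℚ) =
      (m + g + 2) / (m + 1) * (2 * m + g + 2) * (2 * m + g + 1) * ballot m g := by
  have h : ((2 * m + g + 2).choose (m + 1) : ℚ) * (m + 1) =
      (2 * m + g + 2).choose m * (m + g + 2) := by
    have := Nat.choose_succ_right_eq (2 * m + g + 2) m
    rw [show 2 * m + g + 2 - m = m + g + 2 by omega] at this
    exact_mod_cast this
  rw [choose_eq_ballot] at h
  field_simp
  linear_combination h

lemma partialSum_step_right (m g : ℕ) :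
    partialSum (2 * m + (g + 1) + 2) m =
      2 * partialSum (2 * m + g + 2) m - (2 * m + g + 2) * (2 * m + g + 1) * ballot m g := by
  rw [show 2 * m + (g + 1) + 2 = 2 * m + g + 2 + 1 by ring, partialSum_succ_left,
    choose_eq_ballot]

lemma partialSum_step_left (m g : ℕ) :
    partialSum (2 * (m + 1) + g + 2) (m + 1) = partialSum (2 * m + (g + 2) + 2) m
      + (m + g + 4) / (m + 1) * (2 * m + g + 4) * (2 * m + g + 3) * ballot m (g + 2) := by
  rw [show 2 * (m + 1) + g + 2 = 2 * m + (g + 2) + 2 by ring, partialSum_succ_right,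
    choose_succ_eq_ballot]
  push_cast
  ring

lemma partialSum_zero_step (m : ℕ) :
    partialSum (2 * (m + 1) + 0 + 2) (m + 1) = 4 * partialSum (2 * m + 0 + 2) m
      + 2 * (2 * m + 1) * ballot m 0 := by
  have h₀ := choose_succ_eq_ballot m 0
  have h₁ := choose_succ_eq_ballot (m + 1) 0
  rw [ballot_succ_left, ballot_succ_right] at h₁
  simp only [add_zero] at h₀ h₁ ⊢
  rw [partialSum_two_mul_add_two, partialSum_two_mul_add_two, h₀, h₁]
  push_cast
  field_simp
  ring

/-- Increment of `count0` in its second argument. -/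
lemma count0_diff (m g : ℕ) :
    count0 (m + 1) (g + 1) = count0 (m + 1) g + count0 m (g + 2) := by
  simp only [count0, ballot_succ_left, ballot_succ_right m (g + 1)]
  push_cast
  field_simp
  ring

lemma count1_diff (m g : ℕ) :
    count1 (m + 1) (g + 1) = count1 (m + 1) g + count1 m (g + 2)
      + (g + 2) * (g + 1) / 2 * count0 m (g + 1) := by
  simp only [count0, count1, ballot_succ_left, partialSum_step_left,
    ballot_succ_right m (g + 1), ballot_succ_right m (g + 2),
    partialSum_step_right m (g + 1), partialSum_step_right m (g + 2)]
  push_cast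
  field_simp
  ring

lemma count2_diff (m g : ℕ) :
    count2 (m + 1) (g + 1) = count2 (m + 1) g + count2 m (g + 2)
      + 2 * ((g + 2) * (g + 1) / 2) * count1 m (g + 1)
      + ((g + 2) * (g + 1) / 2) ^ 2 * count0 m (g + 1) := by
  simp only [count0, count1, count2, ballot_succ_left, partialSum_step_left,
    ballot_succ_right m (g + 1), ballot_succ_right m (g + 2),
    partialSum_step_right m (g + 1), partialSum_step_right m (g + 2)]
  push_cast
  have h₁ : (2 * (m : ℚ) + (g + 1)) ≠ 0 := by positivity
  have h₂ : (2 * (m : ℚ) + (g + 2)) ≠ 0 := by positivity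
  have h₃ : (2 * ((m : ℚ) + 1) + (g + 1)) ≠ 0 := by positivity
  have h₄ : (2 * ((m : ℚ) + 1) + g) ≠ 0 := by positivity
  field_simp
  ring

lemma count0_succ_zero (m : ℕ) : count0 (m + 1) 0 = count0 m 1 + count0 m 0 := by
  simp only [count0, ballot_succ_left, ballot_succ_right m 0]
  push_cast
  field_simp
  ring

lemma count1_succ_zero (m : ℕ) : count1 (m + 1) 0 = count1 m 1 + count1 m 0 := by
  simp only [count1, ballot_succ_left, ballot_succ_right m 0, partialSum_zero_step,
    partialSum_step_right m 0]
  push_cast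
  field_simp
  ring

lemma count2_succ_zero (m : ℕ) : count2 (m + 1) 0 = count2 m 1 + count2 m 0 := by
  simp only [count2, ballot_succ_left, ballot_succ_right m 0, partialSum_zero_step,
    partialSum_step_right m 0]
  rcases Nat.eq_zero_or_pos m with rfl | hm
  · simp only [partialSum_zero_right, ballot_zero_left]
    norm_num
  have : (m : ℚ) ≠ 0 := by positivity
  push_cast
  field_simp
  ring

lemma cast_choose_succ_two (k : ℕ) : ((k + 1).choose 2 : ℚ) = (k + 1) * k / 2 := by
  rw [Nat.cast_choose_two]
  push_cast
  ring

lemma count0_succ (m g : ℕ) :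
    count0 (m + 1) g = count0 m (g + 1) + ∑ k ∈ range (g + 1), count0 m k := by
  induction g with
  | zero => simp [count0_succ_zero]
  | succ g ih =>
    rw [count0_diff, ih, sum_range_succ _ (g + 1)]
    ring

lemma count1_succ (m g : ℕ) :
    count1 (m + 1) g = count1 m (g + 1)
      + ∑ k ∈ range (g + 1), (count1 m k + (k + 1).choose 2 * count0 m k) := by
  induction g with
  | zero => simp [count1_succ_zero]
  | succ g ih =>
    rw [count1_diff, ih, sum_range_succ _ (g + 1), cast_choose_succ_two (g + 1)]
    push_cast
    ring

lemma count2_succ (m g : ℕ) :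
    count2 (m + 1) g = count2 m (g + 1)
      + ∑ k ∈ range (g + 1), (count2 m k + 2 * (k + 1).choose 2 * count1 m k
        + ((k + 1).choose 2 : ℚ) ^ 2 * count0 m k) := by
  induction g with
  | zero => simp [count2_succ_zero]
  | succ g ih =>
    rw [count2_diff, ih, sum_range_succ _ (g + 1), cast_choose_succ_two (g + 1)]
    push_cast
    ring

lemma catalan_eq_ballot (m : ℕ) : (catalan m : ℚ) = (m + 2) * ballot m 0 := by
  have h : ((m : ℚ) + 1) * catalan m = (2 * m).choose m := by
    exact_mod_cast succ_mul_catalan_eq_centralBinom m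
  rw [two_mul, Nat.cast_add_choose] at h
  have h₁ := Nat.cast_ne_zero (R := ℚ).2 (Nat.factorial_ne_zero m)
  simp only [ballot, add_zero, Nat.factorial_succ, two_mul]
  push_cast
  field_simp at h ⊢
  linear_combination (m + 2 : ℚ) * h

lemma count2_zero_right (m : ℕ) :
    count2 m 0 = -(9 / 128) * (3 * (m + 1 : ℚ) ^ 2 + 7 * (m + 1 : ℚ) + 6) * 4 ^ (m + 1)
      + ((19 / 60) * (m + 1 : ℚ) ^ 4 + (57 / 20) * (m + 1 : ℚ) ^ 3
        + (67 / 30) * (m + 1 : ℚ) ^ 2 + (1 / 10) * (m + 1 : ℚ) - 1) * catalan m := by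
  have h := choose_succ_eq_ballot m 0
  simp only [add_zero] at h
  simp only [count2, catalan_eq_ballot, add_zero, partialSum_two_mul_add_two, h]
  rcases Nat.eq_zero_or_pos m with rfl | hm
  · simp only [ballot_zero_left]
    norm_num
  have : (m : ℚ) ≠ 0 := by positivity
  push_cast
  field_simp
  ring

/-- Append a last entry with value `k` to `π`, shifting up the values that are at least `k`. -/
def appendValue {n : ℕ} (k : Fin (n + 1)) (π : Equiv.Perm (Fin n)) : Equiv.Perm (Fin (n + 1)) :=
  (finSuccEquivLast.trans (Equiv.optionCongr π)).trans (finSuccEquiv' k).symm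

@[simp]
lemma appendValue_last {n : ℕ} (k : Fin (n + 1)) (π : Equiv.Perm (Fin n)) :
    appendValue k π (Fin.last n) = k := by
  simp [appendValue]

@[simp]
lemma appendValue_castSucc {n : ℕ} (k : Fin (n + 1)) (π : Equiv.Perm (Fin n)) (i : Fin n) :
    appendValue k π i.castSucc = k.succAbove (π i) := by
  simp [appendValue]

lemma appendValue_bijective (n : ℕ) :
    Function.Bijective
      (fun q : Fin (n + 1) × Equiv.Perm (Fin n) => appendValue q.1 q.2) := by
  rw [Fintype.bijective_iff_injective_and_card]
  refine ⟨?_, by simp [Fintype.card_perm, Nat.factorial_succ]⟩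
  rintro ⟨k, π⟩ ⟨k', π'⟩ h
  have hk : k = k' := by simpa using Equiv.congr_fun h (Fin.last n)
  subst hk
  have hπ : π = π' := by
    ext1 i
    simpa using Equiv.congr_fun h i.castSucc
  rw [hπ]

/-- No ascent of `π` ends strictly below `k`. -/
def AscentsAbove {n : ℕ} (k : ℕ) (π : Equiv.Perm (Fin n)) : Prop :=
  ∀ i j : Fin n, i < j → π i < π j → k ≤ π j

open Classical in
/-- The number of values lying below every entry that ends an ascent of `π`. -/
noncomputable def label {n : ℕ} (π : Equiv.Perm (Fin n)) : ℕ :=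
  Nat.findGreatest (fun k => AscentsAbove k π) n

lemma AscentsAbove.mono {n k k' : ℕ} {π : Equiv.Perm (Fin n)} (h : AscentsAbove k π)
    (hk : k' ≤ k) : AscentsAbove k' π :=
  fun i j hij hπ => hk.trans (h i j hij hπ)

lemma label_le {n : ℕ} (π : Equiv.Perm (Fin n)) : label π ≤ n := by
  classical
  exact Nat.findGreatest_le n

lemma ascentsAbove_label {n : ℕ} (π : Equiv.Perm (Fin n)) : AscentsAbove (label π) π := by
  classical
  exact Nat.findGreatest_spec (P := fun k => AscentsAbove k π) (Nat.zero_le n)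
    (fun _ _ _ _ => Nat.zero_le _)

lemma ascentsAbove_iff {n k : ℕ} (π : Equiv.Perm (Fin n)) (hk : k ≤ n) :
    AscentsAbove k π ↔ k ≤ label π := by
  classical
  exact ⟨fun h => Nat.le_findGreatest hk h, (ascentsAbove_label π).mono⟩

lemma label_eq_of_forall {n h : ℕ} {π : Equiv.Perm (Fin n)} (hn : h ≤ n)
    (H : ∀ k ≤ n, AscentsAbove k π ↔ k ≤ h) : label π = h :=
  le_antisymm ((H _ (label_le π)).1 (ascentsAbove_label π))
    ((ascentsAbove_iff π hn).1 ((H h hn).2 le_rfl))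

lemma ascentsAbove_appendValue {n k' : ℕ} (k : Fin (n + 1)) (π : Equiv.Perm (Fin n)) :
    AscentsAbove k' (appendValue k π) ↔
      (∀ i j : Fin n, i < j → π i < π j → k' ≤ k.succAbove (π j)) ∧
        (∀ i : Fin n, k.succAbove (π i) < k → k' ≤ k) := by
  simp only [AscentsAbove, Fin.forall_fin_succ', appendValue_castSucc, appendValue_last,
    Fin.castSucc_lt_castSucc_iff, Fin.succAbove_lt_succAbove_iff, Fin.castSucc_lt_last,
    lt_irrefl, not_lt_of_gt (Fin.castSucc_lt_last _), forall_const, false_imp_iff,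
    implies_true, and_true, forall_and]

lemma label_appendValue_zero {n : ℕ} (π : Equiv.Perm (Fin n)) :
    label (appendValue 0 π) = label π + 1 := by
  refine label_eq_of_forall (Nat.succ_le_succ (label_le π)) fun k hk => ?_
  rw [ascentsAbove_appendValue]
  cases k with
  | zero => simp
  | succ k =>
    rw [Nat.succ_le_succ_iff, ← ascentsAbove_iff π (Nat.succ_le_succ_iff.1 hk)]
    simp [AscentsAbove]

lemma label_appendValue_of_pos {n : ℕ} {k : Fin (n + 1)} {π : Equiv.Perm (Fin n)}
    (hk : k ≠ 0) (hkl : k ≤ label π) : label (appendValue k π) = k := by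
  refine label_eq_of_forall (Nat.le_of_lt k.2) fun k' _ => ?_
  rw [ascentsAbove_appendValue]
  constructor
  · rintro ⟨-, h⟩
    obtain ⟨i, rfl⟩ : ∃ i, k = Fin.succ i := ⟨k.pred hk, (Fin.succ_pred k hk).symm⟩
    refine h (π.symm ⟨0, i.pos⟩) ?_
    rw [Fin.succAbove_lt_iff_castSucc_lt]
    simp [Fin.lt_def]
  · refine fun h => ⟨fun i j hij hπ => ?_, fun _ _ => h⟩
    have hj := (ascentsAbove_label π).mono hkl i j hij hπ
    rw [Fin.succAbove_of_le_castSucc _ _ hj, Fin.val_succ]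
    omega

lemma avoids123_appendValue {n : ℕ} (k : Fin (n + 1)) (π : Equiv.Perm (Fin n)) :
    avoids123 (appendValue k π) ↔ avoids123 π ∧ k ≤ label π := by
  rw [← ascentsAbove_iff π (Nat.le_of_lt_succ k.2)]
  constructor
  · refine fun h => ⟨fun i j l hij hjl hπ => ?_, fun i j hij hπ => ?_⟩
    · exact h i.castSucc j.castSucc l.castSucc (by simpa) (by simpa) (by simpa)
    · by_contra! hk
      refine h i.castSucc j.castSucc (Fin.last n) (by simpa) (Fin.castSucc_lt_last j) ?_
      rw [appendValue_castSucc, appendValue_castSucc, appendValue_last,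
        Fin.succAbove_lt_succAbove_iff, Fin.succAbove_lt_iff_castSucc_lt]
      exact ⟨hπ, hk⟩
  · rintro ⟨h, hk⟩ i j l hij hjl hσ
    obtain ⟨j, rfl⟩ : ∃ j' : Fin n, j = j'.castSucc :=
      ⟨j.castPred (Fin.ne_last_of_lt hjl), by simp⟩
    obtain ⟨i, rfl⟩ : ∃ i' : Fin n, i = i'.castSucc :=
      ⟨i.castPred (Fin.ne_last_of_lt hij), by simp⟩
    rw [Fin.castSucc_lt_castSucc_iff] at hij
    induction l using Fin.lastCases with
    | last =>
      rw [appendValue_castSucc, appendValue_castSucc, appendValue_last,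
        Fin.succAbove_lt_succAbove_iff, Fin.succAbove_lt_iff_castSucc_lt] at hσ
      exact absurd (hk i j hij hσ.1) (not_le_of_gt hσ.2)
    | cast l => exact h i j l hij (by simpa using hjl) (by simpa using hσ)

lemma card_inversions_below {n k : ℕ} {π : Equiv.Perm (Fin n)} (hkn : k ≤ n)
    (hk : AscentsAbove k π) :
    (univ.filter fun p : Fin n × Fin n =>
      p.1 < p.2 ∧ π p.2 < π p.1 ∧ (π p.1 : ℕ) < k).card = k.choose 2 := by
  have hcard : ((range k).sigma fun v => range v).card = k.choose 2 := by
    rw [card_sigma, Nat.choose_two_right, ← sum_range_id]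
    simp
  rw [← hcard]
  refine card_nbij (fun p => ⟨π p.1, π p.2⟩) ?_ ?_ ?_
  · rintro ⟨i, j⟩ h
    simp at h ⊢
    exact ⟨h.2.2, h.2.1⟩
  · rintro ⟨i, j⟩ - ⟨i', j'⟩ - h
    simpa [Fin.val_inj] using h
  · rintro ⟨v, w⟩ h
    simp at h
    obtain ⟨hv, hw⟩ := h
    refine ⟨(π.symm ⟨v, by omega⟩, π.symm ⟨w, by omega⟩), ?_, by simp⟩
    simp only [coe_filter, mem_univ, true_and, Set.mem_ofPred_eq, Equiv.apply_symm_apply,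
      Fin.mk_lt_mk]
    refine ⟨?_, hw, hv⟩
    by_contra! hle
    rcases hle.lt_or_eq with hlt | heq
    · have := hk _ _ hlt (by simpa using hw)
      simp at this
      omega
    · simp at heq
      omega

lemma a213_appendValue {n : ℕ} {k : Fin (n + 1)} {π : Equiv.Perm (Fin n)}
    (hk : k ≤ label π) :
    a213 (appendValue k π) = a213 π + (k : ℕ).choose 2 := by
  rw [← card_inversions_below (Nat.le_of_lt_succ k.2) ((ascentsAbove_label π).mono hk)]
  have hval : ∀ x : Fin n, ((x : ℕ) < k) = (x.castSucc < k) := fun _ => rfl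
  simp only [a213, card_filter, Fintype.sum_prod_type, Fin.sum_univ_castSucc, hval,
    appendValue_castSucc, appendValue_last, Fin.castSucc_lt_castSucc_iff,
    Fin.succAbove_lt_succAbove_iff, Fin.succAbove_lt_iff_castSucc_lt, Fin.castSucc_lt_last,
    not_lt_of_ge (Fin.le_last _), sum_add_distrib, true_and, false_and, and_false, if_false,
    sum_const_zero, add_zero]

lemma sum_AV123_succ {M : Type*} [AddCommMonoid M] (n : ℕ) (f : ℕ → ℕ → M) :
    ∑ σ ∈ AV123 (n + 1), f (label σ) (a213 σ) =
      ∑ π ∈ AV123 n, (f (label π + 1) (a213 π)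
        + ∑ k ∈ range (label π), f (k + 1) (a213 π + (k + 1).choose 2)) := by
  simp only [AV123, sum_filter]
  rw [← (appendValue_bijective n).sum_comp, Fintype.sum_prod_type_right]
  refine sum_congr rfl fun π _ => ?_
  by_cases hπ : avoids123 π
  · simp only [avoids123_appendValue, hπ, true_and, if_true]
    rw [Fin.sum_univ_succ, if_pos (by simp), label_appendValue_zero, a213_appendValue (by simp)]
    congr 1
    have hterm : ∀ k : Fin n,
        (if ((k.succ : Fin (n + 1)) : ℕ) ≤ label π then
          f (label (appendValue k.succ π)) (a213 (appendValue k.succ π)) else 0) =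
        if (k : ℕ) + 1 ≤ label π then f (k + 1) (a213 π + (k + 1 : ℕ).choose 2) else 0 := by
      intro k
      rw [Fin.val_succ]
      split_ifs with h
      · rw [label_appendValue_of_pos (Fin.succ_ne_zero k) (by simpa using h),
          a213_appendValue (by simpa using h), Fin.val_succ]
      · rfl
    rw [sum_congr rfl fun k _ => hterm k,
      Fin.sum_univ_eq_sum_range (fun k => if k + 1 ≤ label π then
        f (k + 1) (a213 π + (k + 1).choose 2) else 0) n, ← sum_filter]
    refine sum_congr ?_ fun _ _ => rfl
    ext k
    have := label_le π
    simp only [mem_filter, mem_range]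
    omega
  · simp [avoids123_appendValue, hπ]

lemma one_le_label {n : ℕ} (hn : 1 ≤ n) (π : Equiv.Perm (Fin n)) : 1 ≤ label π := by
  rw [← ascentsAbove_iff π hn]
  intro i j _ hπ
  exact Nat.one_le_iff_ne_zero.2 (Nat.ne_zero_of_lt hπ)

lemma sum_sq_a213_add (m : ℕ) {n : ℕ} (hn : 1 ≤ n) :
    ∑ π ∈ AV123 (n + m), (a213 π : ℚ) ^ 2 =
      ∑ π ∈ AV123 n, (count0 m (label π - 1) * (a213 π : ℚ) ^ 2
        + 2 * count1 m (label π - 1) * a213 π + count2 m (label π - 1)) := by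
  induction m generalizing n with
  | zero => simp [count0_zero_left, count1_zero_left, count2_zero_left]
  | succ m ih =>
    rw [show n + (m + 1) = n + 1 + m by ring, ih (Nat.le_add_left 1 n),
      sum_AV123_succ n fun h a =>
        count0 m (h - 1) * (a : ℚ) ^ 2 + 2 * count1 m (h - 1) * a + count2 m (h - 1)]
    refine sum_congr rfl fun π _ => ?_
    obtain ⟨g, hg⟩ := Nat.exists_eq_add_of_le' (one_le_label hn π)
    generalize a213 π = a
    simp only [hg, Nat.add_sub_cancel]
    have hsum : ∑ k ∈ range (g + 1),
          (count0 m k * ((a + (k + 1).choose 2 : ℕ) : ℚ) ^ 2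
            + 2 * count1 m k * ((a + (k + 1).choose 2 : ℕ) : ℚ) + count2 m k) =
        (a : ℚ) ^ 2 * ∑ k ∈ range (g + 1), count0 m k
          + 2 * a * ∑ k ∈ range (g + 1), (count1 m k + (k + 1).choose 2 * count0 m k)
          + ∑ k ∈ range (g + 1), (count2 m k + 2 * (k + 1).choose 2 * count1 m k
            + ((k + 1).choose 2 : ℚ) ^ 2 * count0 m k) := by
      simp only [mul_sum, ← sum_add_distrib]
      refine sum_congr rfl fun k _ => ?_
      push_cast
      ring
    rw [hsum, count0_succ, count1_succ, count2_succ]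
    ring

/-- For `n ≥ 1`, `∑_{π ∈ AV₁₂₃(n)} a₂₁₃(π)² =
-(9/128)(3n²+7n+6)·4^n + ((19/60)n⁴+(57/20)n³+(67/30)n²+(1/10)n−1)·c_{n-1}`. -/
theorem sum_sq_a213_over_AV123 (n : ℕ) (hn : 1 ≤ n) :
    (∑ π ∈ AV123 n, ((a213 π : ℚ)) ^ 2) =
      -(9 / 128) * (3 * (n : ℚ) ^ 2 + 7 * (n : ℚ) + 6) * 4 ^ n
        + ((19 / 60) * (n : ℚ) ^ 4 + (57 / 20) * (n : ℚ) ^ 3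
            + (67 / 30) * (n : ℚ) ^ 2 + (1 / 10) * (n : ℚ) - 1)
          * (catalan (n - 1) : ℚ) := by
  obtain ⟨m, rfl⟩ := Nat.exists_eq_add_of_le hn
  have hlabel : ∀ π : Equiv.Perm (Fin 1), label π = 1 := fun π =>
    le_antisymm (label_le π) (one_le_label le_rfl π)
  have ha : ∀ π : Equiv.Perm (Fin 1), a213 π = 0 := by decide
  have hAV : (AV123 1).card = 1 := by decide
  rw [sum_sq_a213_add m le_rfl]
  simp only [hlabel, ha, sum_const, hAV, Nat.sub_self, Nat.add_sub_cancel_left, count2_zero_right]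
  push_cast
  ring
end
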